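/- Let C be a monoidal category with finite products and finite coproducts, such that for every object A the functor A ⊗ − preserves finite products and the functor − ⊗ A preserves finite coproducts. Then for all objects A, B of C, the canonical morphism [⟨1_A, 0⟩, ⟨0, 1_B⟩] : A + B → A × B is an isomorphism, with inverse the composite (π₁ + π₂) ∘ t_{A,B}⁻¹ ∘ (i₁ × i₂) : A × B → A + B. -/

import Mathlib

open CategoryTheory CategoryTheory.Limits CategoryTheory.MonoidalCategory

/-- The comparison morphism `X ⊗ (𝟙_ C ⨯ 𝟙_ C) ⟶ X ⨯ X`. -/
noncomputable def tensorUnitProdToProd {C : Type*} [Category C] [MonoidalCategory C]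
    [HasBinaryProducts C] (X : C) : X ⊗ (𝟙_ C ⨯ 𝟙_ C) ⟶ X ⨯ X :=
  prodComparison (tensorLeft X) (𝟙_ C) (𝟙_ C) ≫ prod.map (ρ_ X).hom (ρ_ X).hom

instance {C : Type*} [Category C] [MonoidalCategory C] [HasBinaryProducts C] (X : C)
    [PreservesLimitsOfShape (Discrete WalkingPair) (tensorLeft X)] :
    IsIso (tensorUnitProdToProd X) := by
  unfold tensorUnitProdToProd
  infer_instance

theorem tensorUnitProdToProd_naturality {C : Type*} [Category C] [MonoidalCategory C]
    [HasBinaryProducts C] {X Y : C} (f : X ⟶ Y) :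
    tensorUnitProdToProd X ≫ prod.map f f = f ▷ (𝟙_ C ⨯ 𝟙_ C) ≫ tensorUnitProdToProd Y := by
  ext <;> simp [tensorUnitProdToProd, prodComparison, prod.lift_fst, prod.lift_snd,
    ← whisker_exchange_assoc]

/-- The canonical morphism `(A ⨯ A) ⨿ (B ⨯ B) ⟶ (A ⨿ B) ⨯ (A ⨿ B)` is an isomorphism when tensoring
on the left preserves binary products and tensoring on the right preserves binary coproducts. -/
theorem isIso_coprod_desc_prod_map_inl_inr {C : Type*} [Category C] [MonoidalCategory C]
    [HasBinaryProducts C] [HasBinaryCoproducts C]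
    [∀ X : C, PreservesLimitsOfShape (Discrete WalkingPair) (tensorLeft X)]
    [∀ X : C, PreservesColimitsOfShape (Discrete WalkingPair) (tensorRight X)] (A B : C) :
    IsIso (coprod.desc
      (prod.map (coprod.inl : A ⟶ A ⨿ B) (coprod.inl : A ⟶ A ⨿ B))
      (prod.map (coprod.inr : B ⟶ A ⨿ B) (coprod.inr : B ⟶ A ⨿ B))) := by
  have h : coprod.map (tensorUnitProdToProd A) (tensorUnitProdToProd B) ≫
      coprod.desc (prod.map coprod.inl coprod.inl) (prod.map coprod.inr coprod.inr) =
      coprodComparison (tensorRight (𝟙_ C ⨯ 𝟙_ C)) A B ≫ tensorUnitProdToProd (A ⨿ B) := by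
    rw [coprod.map_desc, tensorUnitProdToProd_naturality, tensorUnitProdToProd_naturality,
      coprodComparison, coprod.desc_comp]
    rfl
  have : IsIso (coprod.map (tensorUnitProdToProd A) (tensorUnitProdToProd B) ≫
      coprod.desc (prod.map (coprod.inl : A ⟶ A ⨿ B) (coprod.inl : A ⟶ A ⨿ B))
        (prod.map (coprod.inr : B ⟶ A ⨿ B) (coprod.inr : B ⟶ A ⨿ B))) := by
    rw [h]
    infer_instance
  exact IsIso.of_isIso_comp_left (coprod.map (tensorUnitProdToProd A) (tensorUnitProdToProd B)) _

/-- In a monoidal category with finite products and coproducts where `A ⊗ -`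
preserves finite products and `- ⊗ A` preserves finite coproducts (such a category
has a zero object, so it has (unique) zero morphisms, which we fix), the canonical
morphism `[⟨1,0⟩, ⟨0,1⟩] : A ⨿ B ⟶ A ⨯ B` is an isomorphism, with inverse
`(π₁ + π₂) ∘ t_{A,B}⁻¹ ∘ (i₁ × i₂)`, where `t_{A,B} = [i₁ × i₁, i₂ × i₂]` is an
isomorphism (witnessed by a two-sided inverse `tinv`). -/
theorem canonical_coprod_to_prod_iso
    {C : Type u} [Category.{v} C] [MonoidalCategory C]
    [HasFiniteProducts C] [HasFiniteCoproducts C]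
    [∀ A : C, PreservesFiniteProducts (tensorLeft A)]
    [∀ A : C, PreservesFiniteCoproducts (tensorRight A)]
    [HasZeroMorphisms C] (A B : C) :
    ∃ tinv : (A ⨿ B) ⨯ (A ⨿ B) ⟶ (A ⨯ A) ⨿ (B ⨯ B),
      (coprod.desc
          (prod.map (coprod.inl : A ⟶ A ⨿ B) (coprod.inl : A ⟶ A ⨿ B))
          (prod.map (coprod.inr : B ⟶ A ⨿ B) (coprod.inr : B ⟶ A ⨿ B))) ≫ tinv =
        𝟙 ((A ⨯ A) ⨿ (B ⨯ B)) ∧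
      tinv ≫ (coprod.desc
          (prod.map (coprod.inl : A ⟶ A ⨿ B) (coprod.inl : A ⟶ A ⨿ B))
          (prod.map (coprod.inr : B ⟶ A ⨿ B) (coprod.inr : B ⟶ A ⨿ B))) =
        𝟙 ((A ⨿ B) ⨯ (A ⨿ B)) ∧
      coprod.desc (prod.lift (𝟙 A) (0 : A ⟶ B)) (prod.lift (0 : B ⟶ A) (𝟙 B)) ≫
          (prod.map (coprod.inl : A ⟶ A ⨿ B) (coprod.inr : B ⟶ A ⨿ B) ≫ tinv ≫
            coprod.map (prod.fst : A ⨯ A ⟶ A) (prod.snd : B ⨯ B ⟶ B)) =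
        𝟙 (A ⨿ B) ∧
      (prod.map (coprod.inl : A ⟶ A ⨿ B) (coprod.inr : B ⟶ A ⨿ B) ≫ tinv ≫
          coprod.map (prod.fst : A ⨯ A ⟶ A) (prod.snd : B ⨯ B ⟶ B)) ≫
          coprod.desc (prod.lift (𝟙 A) (0 : A ⟶ B)) (prod.lift (0 : B ⟶ A) (𝟙 B)) =
        𝟙 (A ⨯ B) := by
  have := isIso_coprod_desc_prod_map_inl_inr A B
  set t := coprod.desc
    (prod.map (coprod.inl : A ⟶ A ⨿ B) (coprod.inl : A ⟶ A ⨿ B))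
    (prod.map (coprod.inr : B ⟶ A ⨿ B) (coprod.inr : B ⟶ A ⨿ B)) with ht
  refine ⟨inv t, IsIso.hom_inv_id t, IsIso.inv_hom_id t, ?_, ?_⟩
  · have hA : prod.lift (𝟙 A) (0 : A ⟶ B) ≫ prod.map coprod.inl coprod.inr =
        (prod.lift (𝟙 A) 0 ≫ coprod.inl) ≫ t := by
      ext <;> simp [ht, prod.lift_fst, prod.lift_snd, coprod.inl_desc]
    have hB : prod.lift (0 : B ⟶ A) (𝟙 B) ≫ prod.map coprod.inl coprod.inr =
        (prod.lift 0 (𝟙 B) ≫ coprod.inr) ≫ t := by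
      ext <;> simp [ht, prod.lift_fst, prod.lift_snd, coprod.inr_desc]
    ext
    · rw [coprod.inl_desc_assoc, reassoc_of% hA]
      simp [prod.lift_fst_assoc]
    · rw [coprod.inr_desc_assoc, reassoc_of% hB]
      simp [prod.lift_snd_assoc]
  · have hA : coprod.map (prod.fst : A ⨯ A ⟶ A) (prod.snd : B ⨯ B ⟶ B) ≫
        coprod.desc (𝟙 A) 0 = t ≫ prod.fst ≫ coprod.desc (𝟙 A) 0 := by
      ext <;> simp [ht, coprod.inl_desc, coprod.inr_desc]
    have hB : coprod.map (prod.fst : A ⨯ A ⟶ A) (prod.snd : B ⨯ B ⟶ B) ≫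
        coprod.desc 0 (𝟙 B) = t ≫ prod.snd ≫ coprod.desc 0 (𝟙 B) := by
      ext <;> simp [ht, coprod.inl_desc, coprod.inr_desc]
    have hfst : coprod.desc (prod.lift (𝟙 A) (0 : A ⟶ B)) (prod.lift (0 : B ⟶ A) (𝟙 B)) ≫
        prod.fst = coprod.desc (𝟙 A) 0 := by
      ext <;> simp [prod.lift_fst, coprod.inl_desc, coprod.inr_desc]
    have hsnd : coprod.desc (prod.lift (𝟙 A) (0 : A ⟶ B)) (prod.lift (0 : B ⟶ A) (𝟙 B)) ≫
        prod.snd = coprod.desc 0 (𝟙 B) := by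
      ext <;> simp [prod.lift_snd, coprod.inl_desc, coprod.inr_desc]
    apply Limits.prod.hom_ext
    · simp only [Category.assoc, hfst, hA, IsIso.inv_hom_id_assoc]
      simp [coprod.inl_desc]
    · simp only [Category.assoc, hsnd, hB, IsIso.inv_hom_id_assoc]
      simp [coprod.inr_desc]
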